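/- Let n ≥ 3, let Ω ⊆ ℝⁿ be a bounded open set, and let q₁, q₂ : ℝⁿ → ℂ be smooth functions. Suppose that for all smooth functions u₁, u₂ : Ω → ℂ satisfying Δuⱼ(x) = qⱼ(x)·uⱼ(x) for all x ∈ Ω and ∫_Ω (|uⱼ|² + |∇uⱼ|²) dx < ∞ (j = 1, 2), one has ∫_Ω (q₁(x) − q₂(x))·u₁(x)·u₂(x) dx = 0. Then q₁(x) = q₂(x) for all x ∈ Ω. -/

import Mathlib

open MeasureTheory
noncomputable section

/-- Euclidean Laplacian of a complex-valued function: the trace of the Hessian. -/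
def eLap {n : ℕ} (u : EuclideanSpace ℝ (Fin n) → ℂ) (x : EuclideanSpace ℝ (Fin n)) : ℂ :=
  ∑ j : Fin n,
    iteratedFDeriv ℝ 2 u x ![EuclideanSpace.single j 1, EuclideanSpace.single j 1]

/-- The integer vector `k` as a point of Euclidean space. -/
def latVec {n : ℕ} (k : Fin n → ℤ) : EuclideanSpace ℝ (Fin n) :=
  WithLp.toLp 2 fun i => (k i : ℝ)

/-- The plane wave `x ↦ exp (i ξ · x)`. -/
def wave {n : ℕ} (ξ x : EuclideanSpace ℝ (Fin n)) : ℂ :=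
  Complex.exp (Complex.I * (inner ℝ ξ x : ℝ))

/-- A family indexed by the integer lattice which decays faster than every power. -/
def RapidDecay {n : ℕ} (a : (Fin n → ℤ) → ℂ) : Prop :=
  ∀ m : ℕ, Summable fun k => ‖a k‖ * (1 + ‖k‖) ^ m

theorem exists_summable_one_add_norm_inv_pow (n : ℕ) :
    ∃ N : ℕ, Summable fun k : Fin n → ℤ => ((1 + ‖k‖) ^ N)⁻¹ := by
  let L : Submodule ℤ (Fin n → ℝ) := Submodule.span ℤ (Set.range (Pi.basisFun ℝ (Fin n)))
  refine ⟨Module.finrank ℤ L + 1, ?_⟩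
  have h := ZLattice.summable_norm_pow_inv (L := L) (Module.finrank ℤ L + 1) (Nat.lt_succ_self _)
  have hmem (k : Fin n → ℤ) : (fun i => (k i : ℝ)) ∈ L := by
    rw [Module.Basis.mem_span_iff_repr_mem]
    intro i
    exact ⟨k i, by simp⟩
  let φ : (Fin n → ℤ) → L := fun k => ⟨fun i => (k i : ℝ), hmem k⟩
  have hφ : Function.Injective φ := by
    intro k l hkl
    funext i
    have := congrFun (congrArg Subtype.val hkl) i
    simpa [φ] using this
  have hn (k : Fin n → ℤ) : ‖φ k‖ = ‖k‖ := by
    change ‖fun i => (k i : ℝ)‖ = ‖k‖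
    simp only [Pi.norm_def]
    congr 2
  have h2 := h.comp_injective hφ
  simp only [Function.comp_def, hn] at h2
  refine Summable.of_norm_bounded_eventually h2 ?_
  filter_upwards [(Set.finite_singleton (0 : Fin n → ℤ)).compl_mem_cofinite] with k hk
  have hk0 : 0 < ‖k‖ := norm_pos_iff.mpr hk
  rw [norm_inv, norm_pow, Real.norm_of_nonneg (by positivity)]
  rw [inv_pow]
  gcongr
  linarith

theorem norm_le_norm_latVec {n : ℕ} (k : Fin n → ℤ) : ‖k‖ ≤ ‖latVec k‖ := by
  rw [pi_norm_le_iff_of_nonneg (norm_nonneg _)]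
  intro i
  have := PiLp.norm_apply_le (latVec k) i
  simpa [latVec, Int.norm_eq_abs] using this

theorem rapidDecay_schwartzMap {n : ℕ} (g : SchwartzMap (EuclideanSpace ℝ (Fin n)) ℂ) :
    RapidDecay fun k : Fin n → ℤ => g (latVec k) := by
  intro m
  obtain ⟨N, hN⟩ := exists_summable_one_add_norm_inv_pow n
  have hC := fun x => SchwartzMap.one_add_le_sup_seminorm_apply (𝕜 := ℝ) (m := (m + N, 0))
    (k := m + N) (n := 0) le_rfl le_rfl g x
  simp only [norm_iteratedFDeriv_zero] at hC
  refine Summable.of_nonneg_of_le (fun k => by positivity) (fun k => ?_)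
    (hN.mul_left (2 ^ (m + N) * ((Finset.Iic (m + N, 0)).sup
      fun m => SchwartzMap.seminorm ℝ m.1 m.2) g))
  rw [← div_eq_mul_inv, le_div_iff₀ (by positivity)]
  refine le_trans ?_ (hC (latVec k))
  have h := norm_le_norm_latVec k
  calc ‖g (latVec k)‖ * (1 + ‖k‖) ^ m * (1 + ‖k‖) ^ N
      = (1 + ‖k‖) ^ (m + N) * ‖g (latVec k)‖ := by ring
    _ ≤ _ := by gcongr

theorem wave_eq {n : ℕ} (ξ x : EuclideanSpace ℝ (Fin n)) :
    wave ξ x = Complex.exp (Complex.I * ∑ i, (ξ i : ℂ) * (x i : ℂ)) := by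
  simp [wave, PiLp.inner_apply, mul_comm]

theorem mFourier_coe_eq_wave {n : ℕ} (k : Fin n → ℤ) (x : Fin n → ℝ) :
    UnitAddTorus.mFourier k (fun i => (x i : UnitAddCircle)) =
      wave ((2 * Real.pi) • latVec k) (WithLp.toLp 2 x) := by
  rw [wave_eq, Finset.mul_sum, Complex.exp_sum]
  simp only [UnitAddTorus.mFourier, ContinuousMap.coe_mk, fourier_coe_apply]
  refine Finset.prod_congr rfl fun i _ => ?_
  congr 1
  simp [latVec]
  ring

/-- A continuous function supported well inside the unit cube descends to the torus. -/
theorem exists_torus_lift {n : ℕ} (f : EuclideanSpace ℝ (Fin n) → ℂ) (hf : Continuous f)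
    (hsupp : ∀ x, (∃ i, 1 / 4 < |x i|) → f x = 0) :
    ∃ F : C(UnitAddTorus (Fin n), ℂ), ∀ x : Fin n → ℝ,
      (∀ i, x i ∈ Set.Ioc (-(1 / 2) : ℝ) (-(1 / 2) + 1)) →
        F (fun i => (x i : UnitAddCircle)) = f (WithLp.toLp 2 x) := by
  let r : UnitAddCircle → ℝ := fun y => (AddCircle.equivIoc (1 : ℝ) (-(1 / 2)) y : ℝ)
  have hrcoe (y : UnitAddCircle) : ((r y : ℝ) : UnitAddCircle) = y := 
    (AddCircle.equivIoc (1 : ℝ) (-(1 / 2))).symm_apply_apply y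
  have hrmem (y : UnitAddCircle) : r y ∈ Set.Ioc (-(1 / 2) : ℝ) (-(1 / 2) + 1) :=
    (AddCircle.equivIoc (1 : ℝ) (-(1 / 2)) y).2
  have hrnorm (y : UnitAddCircle) : ‖y‖ = |r y| := by
    conv_lhs => rw [← hrcoe y]
    have := hrmem y
    rw [AddCircle.norm_coe_eq_abs_iff 1 one_ne_zero, abs_one, abs_le]
    constructor <;> linarith [this.1, this.2]
  have hrcont (y : UnitAddCircle) (hy : ‖y‖ < 1 / 2) : ContinuousAt r y := by
    refine continuousAt_subtype_val.comp (AddCircle.continuousAt_equivIoc 1 (-(1 / 2)) ?_)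
    rintro rfl
    have : ‖((-(1 / 2) : ℝ) : UnitAddCircle)‖ = 1 / 2 := by
      rw [(AddCircle.norm_coe_eq_abs_iff 1 one_ne_zero).mpr] <;> norm_num [abs_of_pos]
    linarith
  let F : UnitAddTorus (Fin n) → ℂ := fun y => f (WithLp.toLp 2 fun i => r (y i))
  have hF : Continuous F := by
    rw [continuous_iff_continuousAt]
    intro y
    by_cases h : ∀ i, ‖y i‖ < 1 / 2
    · have : ContinuousAt (fun y : UnitAddTorus (Fin n) => fun i => r (y i)) y :=
        continuousAt_pi.mpr fun i => ContinuousAt.comp (f := fun y : UnitAddTorus (Fin n) => y i)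
          (hrcont _ (h i)) (continuous_apply i).continuousAt
      exact hf.continuousAt.comp
        (ContinuousAt.comp (PiLp.continuous_toLp 2 _).continuousAt this)
    · push Not at h
      obtain ⟨i, hi⟩ := h
      have hev : ∀ᶠ z : UnitAddTorus (Fin n) in nhds y, F z = 0 := by
        have ho : ∀ᶠ z : UnitAddTorus (Fin n) in nhds y, 1 / 4 < ‖z i‖ :=
          (continuous_apply i).norm.continuousAt.eventually_const_lt (by linarith)
        filter_upwards [ho] with z hz
        exact hsupp _ ⟨i, by simpa [hrnorm] using hz⟩
      exact (continuousAt_const (y := (0 : ℂ))).congr (hev.mono fun z hz => hz.symm)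
  refine ⟨⟨F, hF⟩, fun x hx => ?_⟩
  have hrx (i : Fin n) : r (x i : UnitAddCircle) = x i :=
    congrArg Subtype.val ((AddCircle.equivIoc (1 : ℝ) (-(1 / 2))).apply_symm_apply ⟨x i, hx i⟩)
  simp [F, hrx]

open scoped FourierTransform in
theorem hasSum_fourier_lattice {n : ℕ} (f : SchwartzMap (EuclideanSpace ℝ (Fin n)) ℂ)
    (hsupp : ∀ x, (∃ i, 1 / 4 < |x i|) → f x = 0) :
    ∃ a : (Fin n → ℤ) → ℂ, RapidDecay a ∧ ∀ x : EuclideanSpace ℝ (Fin n), (∀ i, |x i| < 1 / 2) →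
      HasSum (fun k => a k * wave ((2 * Real.pi) • latVec k) x) (f x) := by
  obtain ⟨F, hF⟩ := exists_torus_lift f f.continuous hsupp
  have hcoeff (k : Fin n → ℤ) : UnitAddTorus.mFourierCoeff F k = (𝓕 f) (latVec k) := by
    rw [UnitAddTorus.mFourierCoeff_eq_integral F k fun _ => -(1 / 2)]
    have hms : MeasurableSet
        {x : Fin n → ℝ | ∀ i, x i ∈ Set.Ioc (-(1 / 2) : ℝ) (-(1 / 2) + 1)} :=
      MeasurableSet.univ_pi' fun i => measurableSet_Ioc
    rw [setIntegral_congr_fun (g := fun x : Fin n → ℝ =>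
      wave ((2 * Real.pi) • latVec (-k)) (WithLp.toLp 2 x) • f (WithLp.toLp 2 x)) hms
      fun y hy => by simp only [hF y hy, mFourier_coe_eq_wave]]
    rw [setIntegral_eq_integral_of_forall_compl_eq_zero]
    · rw [(PiLp.volume_preserving_toLp (Fin n)).integral_comp
        (MeasurableEquiv.toLp 2 (Fin n → ℝ)).measurableEmbedding
        (fun y => wave ((2 * Real.pi) • latVec (-k)) y • f y), SchwartzMap.fourier_coe,
        Real.fourier_eq']
      congr 1
      funext y
      congr 1
      rw [wave_eq]
      congr 1
      simp [PiLp.inner_apply, latVec, Finset.mul_sum, Finset.sum_mul]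
      refine Finset.sum_congr rfl fun i _ => ?_
      ring
    · intro y hy
      simp only [Set.mem_ofPred_eq, not_forall] at hy
      obtain ⟨i, hi⟩ := hy
      rw [hsupp, smul_zero]
      refine ⟨i, ?_⟩
      by_contra! hlt
      apply hi
      have := abs_le.mp hlt
      simp only at this
      constructor <;> linarith [this.1, this.2]
  refine ⟨_, rapidDecay_schwartzMap (𝓕 f), fun x hx => ?_⟩
  have hs : Summable (UnitAddTorus.mFourierCoeff F) := by
    have := rapidDecay_schwartzMap (𝓕 f) 0
    simp only [pow_zero, mul_one] at this
    exact Summable.of_norm (by simpa only [hcoeff] using this)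
  have := UnitAddTorus.hasSum_mFourier_series_apply_of_summable hs
    (fun i => (x i : UnitAddCircle))
  rw [hF (fun i => x i)] at this
  · simpa only [hcoeff, mFourier_coe_eq_wave, smul_eq_mul] using this
  · intro i
    have := abs_lt.mp (hx i)
    constructor <;> linarith [this.1, this.2]

/-- Every smooth function agrees on a given ball with a rescaled Schwartz function supported in the
ball of radius `1 / 4`. -/
theorem exists_schwartzMap_rescaled {n : ℕ} {R : ℝ} (hR : 0 < R)
    (q : EuclideanSpace ℝ (Fin n) → ℂ) (hq : ContDiff ℝ (⊤ : ℕ∞) q) :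
    ∃ S : SchwartzMap (EuclideanSpace ℝ (Fin n)) ℂ, (∀ x, 1 / 4 < ‖x‖ → S x = 0) ∧
      ∀ x, ‖x‖ < R → S ((8 * R)⁻¹ • x) = q x := by
  obtain ⟨χ, hχ, hχ0, hχ1⟩ : ∃ χ : EuclideanSpace ℝ (Fin n) → ℝ, ContDiff ℝ (⊤ : ℕ∞) χ ∧
      (∀ x, 2 * R ≤ ‖x‖ → χ x = 0) ∧ ∀ x, ‖x‖ ≤ R → χ x = 1 := by
    let χ : ContDiffBump (0 : EuclideanSpace ℝ (Fin n)) := ⟨R, 2 * R, hR, by linarith⟩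
    exact ⟨χ, χ.contDiff, fun x hx => χ.zero_of_le_dist (by simpa using hx),
      fun x hx => χ.one_of_mem_closedBall (by simpa using hx)⟩
  obtain ⟨f, hf⟩ : ∃ f : EuclideanSpace ℝ (Fin n) → ℂ,
      f = fun x => (χ ((8 * R) • x) : ℂ) * q ((8 * R) • x) := ⟨_, rfl⟩
  have hfzero (x : EuclideanSpace ℝ (Fin n)) (hx : 1 / 4 < ‖x‖) : f x = 0 := by
    have : χ ((8 * R) • x) = 0 := by
      apply hχ0
      rw [norm_smul, Real.norm_of_nonneg (by positivity)]
      nlinarith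
    simp [hf, this]
  have hsm : ContDiff ℝ (⊤ : ℕ∞) f := by
    have h1 : ContDiff ℝ (⊤ : ℕ∞) fun x : EuclideanSpace ℝ (Fin n) => (8 * R) • x := by fun_prop
    rw [hf]
    exact (Complex.ofRealCLM.contDiff.comp (hχ.comp h1)).mul (hq.comp h1)
  have hcs : HasCompactSupport f := by
    refine HasCompactSupport.intro (isCompact_closedBall 0 (1 / 4 : ℝ)) fun x hx => hfzero x ?_
    simpa using hx
  refine ⟨hcs.toSchwartzMap hsm, hfzero, fun x hx => ?_⟩
  change f _ = _
  have h8 : (8 * R) • (8 * R)⁻¹ • x = x := smul_inv_smul₀ (by positivity) x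
  rw [hf]
  simp only [h8, hχ1 x hx.le, Complex.ofReal_one, one_mul]

/-- On a ball of radius `R`, every smooth function is the sum of a rapidly converging Fourier
series with frequencies in a lattice depending only on `R`. -/
theorem exists_rapidDecay_hasSum {n : ℕ} {R : ℝ} (hR : 0 < R)
    (q : EuclideanSpace ℝ (Fin n) → ℂ) (hq : ContDiff ℝ (⊤ : ℕ∞) q) :
    ∃ a : (Fin n → ℤ) → ℂ, RapidDecay a ∧ ∀ x, ‖x‖ < R →
      HasSum (fun k => a k * wave ((2 * Real.pi / (8 * R)) • latVec k) x) (q x) := by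
  obtain ⟨S, hS0, hS⟩ := exists_schwartzMap_rescaled hR q hq
  have hsupp (y : EuclideanSpace ℝ (Fin n)) (hy : ∃ i, 1 / 4 < |y i|) : S y = 0 := by
    obtain ⟨i, hi⟩ := hy
    have h1 := PiLp.norm_apply_le y i
    rw [Real.norm_eq_abs] at h1
    exact hS0 y (hi.trans_le h1)
  obtain ⟨a, ha, h⟩ := hasSum_fourier_lattice S hsupp
  refine ⟨a, ha, fun x hx => ?_⟩
  have hcube (i : Fin n) : |((8 * R)⁻¹ • x) i| < 1 / 2 := by
    have h1 := PiLp.norm_apply_le ((8 * R)⁻¹ • x) i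
    rw [Real.norm_eq_abs, norm_smul, norm_inv, Real.norm_of_nonneg (by positivity)] at h1
    refine lt_of_le_of_lt h1 ?_
    rw [inv_mul_lt_iff₀ (by positivity)]
    linarith
  replace h := h _ hcube
  rw [hS x hx] at h
  have hw (k : Fin n → ℤ) : wave ((2 * Real.pi) • latVec k) ((8 * R)⁻¹ • x) =
      wave ((2 * Real.pi / (8 * R)) • latVec k) x := by
    simp only [wave, real_inner_smul_left, real_inner_smul_right]
    congr 3
    ring
  simpa only [hw] using h

theorem norm_wave {n : ℕ} (ξ x : EuclideanSpace ℝ (Fin n)) : ‖wave ξ x‖ = 1 := by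
  rw [wave, mul_comm, Complex.norm_exp_ofReal_mul_I]

theorem wave_add {n : ℕ} (ξ η x : EuclideanSpace ℝ (Fin n)) :
    wave (ξ + η) x = wave ξ x * wave η x := by
  rw [wave, wave, wave, ← Complex.exp_add, inner_add_left]
  push_cast
  ring_nf

theorem contDiff_wave {n : ℕ} (ξ : EuclideanSpace ℝ (Fin n)) : ContDiff ℝ (⊤ : ℕ∞) (wave ξ) := by
  unfold wave
  have : ContDiff ℝ (⊤ : ℕ∞) fun x : EuclideanSpace ℝ (Fin n) => ((inner ℝ ξ x : ℝ) : ℂ) :=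
    Complex.ofRealCLM.contDiff.comp (innerSL ℝ ξ).contDiff
  exact (contDiff_const.mul this).cexp

theorem hasFDerivAt_wave {n : ℕ} (ξ x : EuclideanSpace ℝ (Fin n)) :
    HasFDerivAt (wave ξ)
      ((wave ξ x * Complex.I) • (Complex.ofRealCLM.comp (innerSL ℝ ξ))) x := by
  have h1 : HasFDerivAt (fun x : EuclideanSpace ℝ (Fin n) => ((inner ℝ ξ x : ℝ) : ℂ))
      (Complex.ofRealCLM.comp (innerSL ℝ ξ)) x :=
    (Complex.ofRealCLM.comp (innerSL ℝ ξ)).hasFDerivAt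
  have h2 := (h1.const_mul Complex.I).cexp
  rw [smul_smul] at h2
  exact h2

theorem iteratedDeriv_cexp_I_mul (m : ℕ) :
    iteratedDeriv m (fun t : ℝ => Complex.exp (Complex.I * t)) =
      fun t : ℝ => Complex.I ^ m * Complex.exp (Complex.I * t) := by
  induction m with
  | zero => simp
  | succ m ih =>
    rw [iteratedDeriv_succ, ih]
    funext t
    have h : HasDerivAt (fun t : ℝ => Complex.exp (Complex.I * t))
        (Complex.exp (Complex.I * t) * (Complex.I * 1)) t :=
      (Complex.ofRealCLM.hasDerivAt.const_mul Complex.I).cexp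
    rw [(h.const_mul (Complex.I ^ m)).deriv]
    ring

theorem norm_iteratedFDeriv_wave_le {n : ℕ} (ξ x : EuclideanSpace ℝ (Fin n)) (m : ℕ) :
    ‖iteratedFDeriv ℝ m (wave ξ) x‖ ≤ ‖ξ‖ ^ m := by
  let g : ℝ → ℂ := fun t => Complex.exp (Complex.I * t)
  have hg : ContDiff ℝ (⊤ : ℕ∞) g := (contDiff_const.mul Complex.ofRealCLM.contDiff).cexp
  change ‖iteratedFDeriv ℝ m (g ∘ innerSL ℝ ξ) x‖ ≤ _
  rw [(innerSL ℝ ξ).iteratedFDeriv_comp_right hg x (by exact_mod_cast le_top)]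
  refine (ContinuousMultilinearMap.norm_compContinuousLinearMap_le _ _).trans ?_
  rw [norm_iteratedFDeriv_eq_norm_iteratedDeriv, iteratedDeriv_cexp_I_mul]
  simp

/-- The superposition of plane waves with frequencies `κ` and coefficients `c`. -/
def waveSum {n : ℕ} (κ : (Fin n → ℤ) → EuclideanSpace ℝ (Fin n)) (c : (Fin n → ℤ) → ℂ)
    (x : EuclideanSpace ℝ (Fin n)) : ℂ :=
  ∑' k, c k * wave (κ k) x

theorem RapidDecay.summable_norm {n : ℕ} {a : (Fin n → ℤ) → ℂ} (ha : RapidDecay a) :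
    Summable fun k => ‖a k‖ := by
  simpa using ha 0

theorem RapidDecay.mul_of_growth {n : ℕ} {a : (Fin n → ℤ) → ℂ} (ha : RapidDecay a)
    {d : (Fin n → ℤ) → ℂ} {M : ℝ} {p : ℕ} (hd : ∀ k, ‖d k‖ ≤ M * (1 + ‖k‖) ^ p) :
    RapidDecay fun k => a k * d k := by
  intro m
  refine Summable.of_nonneg_of_le (fun k => by positivity) (fun k => ?_) ((ha (m + p)).mul_left M)
  rw [norm_mul]
  calc ‖a k‖ * ‖d k‖ * (1 + ‖k‖) ^ m ≤ ‖a k‖ * (M * (1 + ‖k‖) ^ p) * (1 + ‖k‖) ^ m := by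
        gcongr
        exact hd k
    _ = _ := by ring

theorem summable_mul_wave {n : ℕ} (κ : (Fin n → ℤ) → EuclideanSpace ℝ (Fin n))
    {c : (Fin n → ℤ) → ℂ} (hc : Summable fun k => ‖c k‖) (x : EuclideanSpace ℝ (Fin n)) :
    Summable fun k => c k * wave (κ k) x :=
  Summable.of_norm (by simpa [norm_wave] using hc)

theorem norm_waveSum_le {n : ℕ} (κ : (Fin n → ℤ) → EuclideanSpace ℝ (Fin n))
    {c : (Fin n → ℤ) → ℂ} (hc : Summable fun k => ‖c k‖) (x : EuclideanSpace ℝ (Fin n)) :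
    ‖waveSum κ c x‖ ≤ ∑' k, ‖c k‖ := by
  refine (norm_tsum_le_tsum_norm (summable_mul_wave κ hc x).norm).trans (le_of_eq ?_)
  simp [norm_wave]

theorem contDiff_waveSum {n : ℕ} {κ : (Fin n → ℤ) → EuclideanSpace ℝ (Fin n)} {M : ℝ}
    (hκ : ∀ k, ‖κ k‖ ≤ M * (1 + ‖k‖)) {c : (Fin n → ℤ) → ℂ} (hc : RapidDecay c) :
    ContDiff ℝ (⊤ : ℕ∞) (waveSum κ c) := by
  refine contDiff_tsum (v := fun m k => M ^ m * (‖c k‖ * (1 + ‖k‖) ^ m))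
    (fun k => contDiff_const.mul (contDiff_wave _)) (fun m _ => (hc m).mul_left _)
    fun m k x _ => ?_
  change ‖iteratedFDeriv ℝ m (c k • wave (κ k)) x‖ ≤ _
  rw [iteratedFDeriv_const_smul_apply
    ((contDiff_wave (κ k)).of_le (by exact_mod_cast le_top)).contDiffAt, norm_smul]
  calc ‖c k‖ * ‖iteratedFDeriv ℝ m (wave (κ k)) x‖ ≤ ‖c k‖ * (M * (1 + ‖k‖)) ^ m := by
        gcongr
        exact (norm_iteratedFDeriv_wave_le _ _ _).trans (by gcongr; exact hκ k)
    _ = _ := by rw [mul_pow]; ring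

theorem fderiv_waveSum {n : ℕ} {κ : (Fin n → ℤ) → EuclideanSpace ℝ (Fin n)} {M : ℝ}
    (hκ : ∀ k, ‖κ k‖ ≤ M * (1 + ‖k‖)) {c : (Fin n → ℤ) → ℂ} (hc : RapidDecay c)
    (x e : EuclideanSpace ℝ (Fin n)) :
    fderiv ℝ (waveSum κ c) x e =
      waveSum κ (fun k => c k * (Complex.I * (inner ℝ (κ k) e : ℝ))) x := by
  have hb (k : Fin n → ℤ) (y : EuclideanSpace ℝ (Fin n)) :
      ‖c k • ((wave (κ k) y * Complex.I) • (Complex.ofRealCLM.comp (innerSL ℝ (κ k))))‖ ≤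
        M * (‖c k‖ * (1 + ‖k‖) ^ 1) := by
    rw [norm_smul, norm_smul, norm_mul, norm_wave, Complex.norm_I, one_mul, one_mul]
    have h1 : ‖Complex.ofRealCLM.comp (innerSL ℝ (κ k))‖ ≤ ‖κ k‖ := by
      refine (ContinuousLinearMap.opNorm_comp_le _ _).trans ?_
      simp
    calc _ ≤ ‖c k‖ * (M * (1 + ‖k‖)) := by gcongr; exact h1.trans (hκ k)
      _ = _ := by ring
  have hs : Summable fun k => M * (‖c k‖ * (1 + ‖k‖) ^ 1) := (hc 1).mul_left M
  have h := hasFDerivAt_tsum (f := fun k y => c k * wave (κ k) y) (x₀ := x) hs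
    (fun k y => (hasFDerivAt_wave (κ k) y).const_mul (c k)) hb
    (summable_mul_wave κ hc.summable_norm x) x
  change HasFDerivAt (waveSum κ c) _ x at h
  rw [h.fderiv]
  have hs' := Summable.of_norm_bounded hs (fun k => hb k x)
  refine ((ContinuousLinearMap.apply ℝ ℂ e).map_tsum hs').trans (tsum_congr fun k => ?_)
  simp
  ring

/-- Convolution of two families indexed by an additive group. -/
def conv {I R : Type*} [AddCommGroup I] [NormedRing R] (a b : I → R) (k : I) : R :=
  ∑' j, a (k - j) * b j

/-- The shear `(k, j) ↦ (k - j, j)`. -/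
def shearEquiv (I : Type*) [AddCommGroup I] : I × I ≃ I × I where
  toFun p := (p.1 - p.2, p.2)
  invFun p := (p.1 + p.2, p.2)
  left_inv p := by simp
  right_inv p := by simp

theorem summable_conv_prod {I R : Type*} [AddCommGroup I] [NormedRing R] [CompleteSpace R]
    {a b : I → R}
    (ha : Summable fun k => ‖a k‖) (hb : Summable fun k => ‖b k‖) :
    Summable fun p : I × I => a (p.1 - p.2) * b p.2 := by
  have h := summable_mul_of_summable_norm ha hb
  exact (shearEquiv I).summable_iff.mpr h

theorem summable_conv_row {I R : Type*} [AddCommGroup I] [NormedRing R] [CompleteSpace R]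
    {a b : I → R}
    (ha : Summable fun k => ‖a k‖) (hb : Summable fun k => ‖b k‖) (k : I) :
    Summable fun j => a (k - j) * b j :=
  (summable_conv_prod ha hb).prod_factor k

theorem hasSum_conv {I R : Type*} [AddCommGroup I] [NormedRing R] [CompleteSpace R]
    {a b : I → R}
    (ha : Summable fun k => ‖a k‖) (hb : Summable fun k => ‖b k‖) :
    HasSum (conv a b) ((∑' k, a k) * ∑' k, b k) := by
  have h := summable_conv_prod ha hb
  rw [tsum_mul_tsum_of_summable_norm ha hb]
  rw [← (shearEquiv I).tsum_eq]
  change HasSum (conv a b) (∑' p : I × I, a (p.1 - p.2) * b p.2)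
  exact h.hasSum.prod_fiberwise fun k => (h.prod_factor k).hasSum

theorem norm_conv_le {I R : Type*} [AddCommGroup I] [NormedRing R] {a b : I → R}
    (ha : Summable fun k => ‖a k‖) (hb : Summable fun k => ‖b k‖) (k : I) :
    ‖conv a b k‖ ≤ conv (fun k => ‖a k‖) (fun k => ‖b k‖) k := by
  have h := summable_conv_row (a := fun k => ‖a k‖) (b := fun k => ‖b k‖)
    (by simpa using ha) (by simpa using hb) k
  exact tsum_of_norm_bounded h.hasSum fun j => norm_mul_le _ _

theorem summable_norm_conv {I R : Type*} [AddCommGroup I] [NormedRing R] [CompleteSpace R]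
    {a b : I → R}
    (ha : Summable fun k => ‖a k‖) (hb : Summable fun k => ‖b k‖) :
    Summable fun k => ‖conv a b k‖ :=
  Summable.of_nonneg_of_le (fun _ => norm_nonneg _) (norm_conv_le ha hb)
    (hasSum_conv (by simpa using ha) (by simpa using hb)).summable

theorem tsum_norm_conv_le {I R : Type*} [AddCommGroup I] [NormedRing R] [CompleteSpace R]
    {a b : I → R}
    (ha : Summable fun k => ‖a k‖) (hb : Summable fun k => ‖b k‖) :
    ∑' k, ‖conv a b k‖ ≤ (∑' k, ‖a k‖) * ∑' k, ‖b k‖ := by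
  have h := hasSum_conv (a := fun k => ‖a k‖) (b := fun k => ‖b k‖)
    (by simpa using ha) (by simpa using hb)
  rw [← h.tsum_eq]
  exact (summable_norm_conv ha hb).tsum_le_tsum (norm_conv_le ha hb) h.summable

theorem conv_sub {I R : Type*} [AddCommGroup I] [NormedRing R] [CompleteSpace R]
    {a b c : I → R}
    (ha : Summable fun k => ‖a k‖) (hb : Summable fun k => ‖b k‖)
    (hc : Summable fun k => ‖c k‖) (k : I) : conv a (b - c) k = conv a b k - conv a c k := by
  rw [conv, conv, conv, ← (summable_conv_row ha hb k).tsum_sub (summable_conv_row ha hc k)]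
  simp [mul_sub]

theorem summable_norm_conv_mul_pow {n : ℕ} {a b : (Fin n → ℤ) → ℂ} {m : ℕ} (ha : RapidDecay a)
    (hb0 : Summable fun k => ‖b k‖) (hb : Summable fun k => ‖b k‖ * (1 + ‖k‖) ^ m) :
    Summable fun k => ‖conv a b k‖ * (1 + ‖k‖) ^ m := by
  let A : (Fin n → ℤ) → ℝ := fun k => ‖a k‖ * (1 + ‖k‖) ^ m
  let B : (Fin n → ℤ) → ℝ := fun k => ‖b k‖ * (1 + ‖k‖) ^ m
  have hA : Summable fun k => ‖A k‖ := (ha m).norm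
  have hB : Summable fun k => ‖B k‖ := hb.norm
  refine Summable.of_nonneg_of_le (fun k => by positivity) (fun k => ?_)
    (hasSum_conv hA hB).summable
  have hN : Summable fun j => ‖a (k - j)‖ * ‖b j‖ :=
    summable_conv_row (a := fun k => ‖a k‖) (b := fun k => ‖b k‖)
      (by simpa using ha.summable_norm) (by simpa using hb0) k
  calc ‖conv a b k‖ * (1 + ‖k‖) ^ m
      ≤ (∑' j, ‖a (k - j)‖ * ‖b j‖) * (1 + ‖k‖) ^ m := by
        gcongr
        exact norm_conv_le ha.summable_norm hb0 k
    _ = ∑' j, ‖a (k - j)‖ * ‖b j‖ * (1 + ‖k‖) ^ m := tsum_mul_right.symm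
    _ ≤ ∑' j, A (k - j) * B j := by
        refine (hN.mul_right _).tsum_le_tsum (fun j => ?_) (summable_conv_row hA hB k)
        have h1 : 1 + ‖k‖ ≤ (1 + ‖k - j‖) * (1 + ‖j‖) := by
          have := norm_add_le (k - j) j
          rw [sub_add_cancel] at this
          nlinarith [norm_nonneg (k - j), norm_nonneg j]
        calc ‖a (k - j)‖ * ‖b j‖ * (1 + ‖k‖) ^ m
            ≤ ‖a (k - j)‖ * ‖b j‖ * ((1 + ‖k - j‖) * (1 + ‖j‖)) ^ m := by gcongr
          _ = A (k - j) * B j := by simp only [A, B, mul_pow]; ring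

/-- A diagonal operator bounded below dominates a convolution operator of small norm. -/
theorem exists_mul_eq_add_conv {I : Type*} [AddCommGroup I] {a g d : I → ℂ} {δ : ℝ} (hδ : 0 < δ)
    (ha : Summable fun k => ‖a k‖) (hg : Summable fun k => ‖g k‖) (hd : ∀ k, δ ≤ ‖d k‖)
    (hsmall : 2 * ∑' k, ‖a k‖ ≤ δ) :
    ∃ b : I → ℂ, (Summable fun k => ‖b k‖) ∧ (∀ k, d k * b k = g k + conv a b k) ∧
      ∑' k, ‖b k‖ ≤ 2 / δ * ∑' k, ‖g k‖ := by
  have hmem (f : I → ℂ) : Memℓp f 1 ↔ Summable fun k => ‖f k‖ := by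
    rw [memℓp_gen_iff (by simp)]
    simp
  have hsum (f : lp (fun _ : I => ℂ) 1) : Summable fun k => ‖f k‖ := (hmem f).mp f.2
  have hnorm (f : lp (fun _ : I => ℂ) 1) : ‖f‖ = ∑' k, ‖f k‖ := by
    rw [lp.norm_eq_tsum_rpow (by simp)]
    simp
  have hdiv (f : I → ℂ) (k : I) : ‖f k / d k‖ ≤ δ⁻¹ * ‖f k‖ := by
    rw [norm_div, div_eq_inv_mul]
    gcongr
    exact hd k
  have hdivs (f : I → ℂ) (hf : Summable fun k => ‖f k‖) : Summable fun k => ‖f k / d k‖ :=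
    Summable.of_nonneg_of_le (fun _ => norm_nonneg _) (hdiv f) (hf.mul_left _)
  have hdivt (f : I → ℂ) (hf : Summable fun k => ‖f k‖) :
      ∑' k, ‖f k / d k‖ ≤ δ⁻¹ * ∑' k, ‖f k‖ := by
    rw [← tsum_mul_left]
    exact (hdivs f hf).tsum_le_tsum (hdiv f) (hf.mul_left _)
  have hadd (f : lp (fun _ : I => ℂ) 1) : Summable fun k => ‖g k + conv a f k‖ :=
    Summable.of_nonneg_of_le (fun _ => norm_nonneg _) (fun _ => norm_add_le _ _)
      (hg.add (summable_norm_conv ha (hsum f)))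
  let T : lp (fun _ : I => ℂ) 1 → lp (fun _ : I => ℂ) 1 := fun f =>
    ⟨fun k => (g k + conv a f k) / d k, (hmem _).mpr (hdivs _ (hadd f))⟩
  have hT : ContractingWith (1 / 2) T := by
    refine ⟨by rw [← NNReal.coe_lt_coe]; norm_num, LipschitzWith.of_dist_le_mul fun f f' => ?_⟩
    rw [dist_eq_norm, dist_eq_norm, hnorm]
    have hfun (k : I) : (T f - T f') k = conv a (f - f' : lp (fun _ : I => ℂ) 1) k / d k := by
      rw [lp.coeFn_sub, lp.coeFn_sub, conv_sub ha (hsum f) (hsum f')]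
      simp only [T, Pi.sub_apply]
      ring
    simp only [hfun]
    refine (hdivt _ (summable_norm_conv ha (hsum _))).trans ?_
    have h1 := tsum_norm_conv_le ha (hsum (f - f'))
    rw [← hnorm] at h1
    calc δ⁻¹ * ∑' k, ‖conv a (f - f' : lp (fun _ : I => ℂ) 1) k‖
        ≤ δ⁻¹ * ((∑' k, ‖a k‖) * ‖f - f'‖) := by gcongr
      _ ≤ δ⁻¹ * (δ / 2 * ‖f - f'‖) := by gcongr; linarith
      _ = _ := by push_cast; field_simp
  obtain ⟨f, hf⟩ : ∃ f, T f = f := ⟨_, hT.fixedPoint_isFixedPt⟩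
  have hfk (k : I) : (g k + conv a f k) / d k = f k := congrFun (congrArg Subtype.val hf) k
  refine ⟨f, hsum f, fun k => ?_, ?_⟩
  · have hdk : d k ≠ 0 := norm_pos_iff.mp (hδ.trans_le (hd k))
    rw [← hfk k]
    field_simp
  · have h1 : ∑' k, ‖f k‖ ≤ δ⁻¹ * (∑' k, ‖g k‖ + δ / 2 * ∑' k, ‖f k‖) := by
      calc ∑' k, ‖f k‖ = ∑' k, ‖(g k + conv a f k) / d k‖ := by simp only [hfk]
        _ ≤ δ⁻¹ * ∑' k, ‖g k + conv a f k‖ := hdivt _ (hadd f)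
        _ ≤ δ⁻¹ * (∑' k, ‖g k‖ + ∑' k, ‖conv a f k‖) := by
            rw [← hg.tsum_add (summable_norm_conv ha (hsum f))]
            gcongr
            · exact hadd f
            · exact hg.add (summable_norm_conv ha (hsum f))
            · exact norm_add_le _ _
        _ ≤ δ⁻¹ * (∑' k, ‖g k‖ + (∑' k, ‖a k‖) * ∑' k, ‖f k‖) := by
            gcongr
            exact tsum_norm_conv_le ha (hsum f)
        _ ≤ _ := by
            gcongr
            linarith
    have h2 : δ⁻¹ * (∑' k, ‖g k‖ + δ / 2 * ∑' k, ‖f k‖) =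
        1 / δ * ∑' k, ‖g k‖ + 1 / 2 * ∑' k, ‖f k‖ := by
      field_simp
    rw [h2] at h1
    have h3 : 2 / δ * ∑' k, ‖g k‖ = 2 * (1 / δ * ∑' k, ‖g k‖) := by ring
    rw [h3]
    linarith

theorem rapidDecay_of_mul_eq_add_conv {n : ℕ} {a g b d : (Fin n → ℤ) → ℂ} {c : ℝ} (hc : 0 < c)
    (ha : RapidDecay a) (hg : RapidDecay g) (hb : Summable fun k => ‖b k‖)
    (hd : ∀ k, c * (1 + ‖k‖) ≤ ‖d k‖) (h : ∀ k, d k * b k = g k + conv a b k) :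
    RapidDecay b := by
  intro m
  induction m with
  | zero => simpa using hb
  | succ m ih =>
    refine Summable.of_nonneg_of_le (fun k => by positivity) (fun k => ?_)
      (((hg m).add (summable_norm_conv_mul_pow ha hb ih)).mul_left c⁻¹)
    have h1 : c * (1 + ‖k‖) * ‖b k‖ ≤ ‖g k‖ + ‖conv a b k‖ := by
      refine le_trans ?_ (norm_add_le _ _)
      rw [← h k, norm_mul]
      gcongr
      exact hd k
    rw [← add_mul, ← div_eq_inv_mul, le_div_iff₀ hc]
    calc ‖b k‖ * (1 + ‖k‖) ^ (m + 1) * c = c * (1 + ‖k‖) * ‖b k‖ * (1 + ‖k‖) ^ m := by ring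
      _ ≤ _ := by gcongr

/-- The complex linear form `e ↦ p · e + i w · e`. -/
def cform {n : ℕ} (p w e : EuclideanSpace ℝ (Fin n)) : ℂ :=
  (inner ℝ p e : ℝ) + Complex.I * (inner ℝ w e : ℝ)

theorem hasFDerivAt_cform {n : ℕ} (p w x : EuclideanSpace ℝ (Fin n)) :
    HasFDerivAt (cform p w) (Complex.ofRealCLM.comp (innerSL ℝ p) +
      Complex.I • Complex.ofRealCLM.comp (innerSL ℝ w)) x :=
  (Complex.ofRealCLM.comp (innerSL ℝ p) +
      Complex.I • Complex.ofRealCLM.comp (innerSL ℝ w)).hasFDerivAt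

theorem contDiff_cform {n : ℕ} (p w : EuclideanSpace ℝ (Fin n)) :
    ContDiff ℝ (⊤ : ℕ∞) (cform p w) :=
  (Complex.ofRealCLM.comp (innerSL ℝ p) +
      Complex.I • Complex.ofRealCLM.comp (innerSL ℝ w)).contDiff

theorem fderiv_cexp_cform_mul {n : ℕ} (p w x e : EuclideanSpace ℝ (Fin n))
    {v : EuclideanSpace ℝ (Fin n) → ℂ} (hv : DifferentiableAt ℝ v x) :
    fderiv ℝ (fun y => Complex.exp (cform p w y) * v y) x e =
      Complex.exp (cform p w x) * (cform p w e * v x + fderiv ℝ v x e) := by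
  have h := (hasFDerivAt_cform p w x).cexp.fun_mul hv.hasFDerivAt
  rw [h.fderiv]
  simp [cform]
  ring

theorem eLap_eq_sum_fderiv {n : ℕ} {u : EuclideanSpace ℝ (Fin n) → ℂ}
    (hu : ContDiff ℝ (⊤ : ℕ∞) u) (x : EuclideanSpace ℝ (Fin n)) :
    eLap u x = ∑ j, fderiv ℝ (fun y => fderiv ℝ u y (EuclideanSpace.single j 1)) x
      (EuclideanSpace.single j 1) := by
  refine Finset.sum_congr rfl fun j _ => ?_
  have h : DifferentiableAt ℝ (fderiv ℝ u) x :=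
    ((hu.fderiv_right (m := (⊤ : ℕ∞)) (by simp)).differentiable (by simp)) x
  rw [iteratedFDeriv_two_apply, fderiv_clm_apply h (by fun_prop)]
  simp

theorem eLap_cexp_cform_mul {n : ℕ} (p w x : EuclideanSpace ℝ (Fin n))
    {v : EuclideanSpace ℝ (Fin n) → ℂ} (hv : ContDiff ℝ (⊤ : ℕ∞) v) :
    eLap (fun y => Complex.exp (cform p w y) * v y) x =
      Complex.exp (cform p w x) * ((∑ j, cform p w (EuclideanSpace.single j 1) ^ 2) * v x +
        ∑ j, (2 * cform p w (EuclideanSpace.single j 1) *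
            fderiv ℝ v x (EuclideanSpace.single j 1) +
          fderiv ℝ (fun y => fderiv ℝ v y (EuclideanSpace.single j 1)) x
            (EuclideanSpace.single j 1))) := by
  have hdv : Differentiable ℝ v := hv.differentiable (by simp)
  have hd2 (e : EuclideanSpace ℝ (Fin n)) : Differentiable ℝ fun y => fderiv ℝ v y e :=
    ((hv.fderiv_right (m := (⊤ : ℕ∞)) (by simp)).differentiable (by simp)).clm_apply
      (differentiable_const e)
  rw [eLap_eq_sum_fderiv ((contDiff_cform p w).cexp.mul hv), Finset.sum_mul,
    ← Finset.sum_add_distrib, Finset.mul_sum]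
  refine Finset.sum_congr rfl fun j _ => ?_
  simp only [fderiv_cexp_cform_mul p w _ _ (hdv _)]
  have hd3 : DifferentiableAt ℝ (fun y => cform p w (EuclideanSpace.single j 1) * v y +
      fderiv ℝ v y (EuclideanSpace.single j 1)) x := ((hdv x).const_mul _).add (hd2 _ x)
  rw [fderiv_cexp_cform_mul p w _ _ hd3]
  rw [fderiv_fun_add ((hdv x).const_mul _) (hd2 _ x), fderiv_const_mul (hdv x)]
  simp
  ring

/-- The symbol of the conjugated Laplacian `Δ + 2 (p + i w) · ∇` at the frequency `ξ`. -/
def conjSymbol {n : ℕ} (p w ξ : EuclideanSpace ℝ (Fin n)) : ℂ :=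
  2 * Complex.I * cform p w ξ - (‖ξ‖ ^ 2 : ℝ)

theorem cform_eq_sum {n : ℕ} (p w ξ : EuclideanSpace ℝ (Fin n)) :
    cform p w ξ = ∑ j, cform p w (EuclideanSpace.single j 1) * ξ j := by
  simp only [cform, PiLp.inner_apply]
  simp [Finset.mul_sum, add_mul, Finset.sum_add_distrib, mul_comm (ξ _), mul_assoc]

theorem conjSymbol_eq_sum {n : ℕ} (p w ξ : EuclideanSpace ℝ (Fin n)) :
    conjSymbol p w ξ = ∑ j, (2 * cform p w (EuclideanSpace.single j 1) *
      (Complex.I * (inner ℝ ξ (EuclideanSpace.single j 1) : ℝ)) +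
      (Complex.I * (inner ℝ ξ (EuclideanSpace.single j 1) : ℝ)) ^ 2) := by
  rw [conjSymbol, cform_eq_sum, EuclideanSpace.real_norm_sq_eq, Finset.mul_sum]
  push_cast
  rw [← Finset.sum_sub_distrib]
  refine Finset.sum_congr rfl fun j _ => ?_
  rw [mul_pow, Complex.I_sq]
  simp [EuclideanSpace.inner_single_right]
  ring

theorem sum_cform_single_sq {n : ℕ} {p w : EuclideanSpace ℝ (Fin n)} (hpw : inner ℝ p w = 0)
    (hn : ‖p‖ = ‖w‖) : ∑ j, cform p w (EuclideanSpace.single j 1) ^ 2 = 0 := by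
  have h1 : ∑ j, p j ^ 2 = ∑ j, w j ^ 2 := by
    rw [← EuclideanSpace.real_norm_sq_eq, ← EuclideanSpace.real_norm_sq_eq, hn]
  have h2 : ∑ j, p j * w j = 0 := by
    rw [← hpw, PiLp.inner_apply]
    simp [mul_comm]
  have h3 (j : Fin n) : cform p w (EuclideanSpace.single j 1) ^ 2 =
      ((p j ^ 2 - w j ^ 2 : ℝ) : ℂ) + 2 * Complex.I * ((p j * w j : ℝ) : ℂ) := by
    simp only [cform, EuclideanSpace.inner_single_right]
    simp
    linear_combination (w j : ℂ) ^ 2 * Complex.I_sq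
  simp only [h3]
  rw [Finset.sum_add_distrib, ← Finset.mul_sum, ← Complex.ofReal_sum, ← Complex.ofReal_sum, h2,
    Finset.sum_sub_distrib, h1]
  simp

theorem latVec_sub {n : ℕ} (k l : Fin n → ℤ) : latVec (k - l) = latVec k - latVec l := by
  ext i
  simp [latVec]

theorem waveSum_conv {n : ℕ} (s : ℝ) (θ : EuclideanSpace ℝ (Fin n)) {a b : (Fin n → ℤ) → ℂ}
    (ha : Summable fun k => ‖a k‖) (hb : Summable fun k => ‖b k‖)
    (x : EuclideanSpace ℝ (Fin n)) :
    waveSum (fun k => s • latVec k + θ) (conv a b) x =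
      waveSum (fun k => s • latVec k) a x * waveSum (fun k => s • latVec k + θ) b x := by
  have h := (hasSum_conv (a := fun k => a k * wave (s • latVec k) x)
    (b := fun k => b k * wave (s • latVec k + θ) x) (by simpa [norm_wave] using ha)
    (by simpa [norm_wave] using hb)).tsum_eq
  rw [waveSum, waveSum, waveSum, ← h]
  refine tsum_congr fun k => ?_
  rw [conv, conv, ← tsum_mul_right]
  refine tsum_congr fun j => ?_
  have h1 : s • latVec k + θ = s • latVec (k - j) + (s • latVec j + θ) := by
    rw [latVec_sub]
    module
  rw [h1, wave_add (s • latVec (k - j))]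
  ring

theorem waveSum_sum {n : ℕ} {ι : Type*} (t : Finset ι)
    (κ : (Fin n → ℤ) → EuclideanSpace ℝ (Fin n)) {c : ι → (Fin n → ℤ) → ℂ}
    (hc : ∀ i ∈ t, Summable fun k => ‖c i k‖) (x : EuclideanSpace ℝ (Fin n)) :
    waveSum κ (fun k => ∑ i ∈ t, c i k) x = ∑ i ∈ t, waveSum κ (c i) x := by
  simp only [waveSum, Finset.sum_mul]
  exact Summable.tsum_finsetSum fun i hi => summable_mul_wave κ (hc i hi) x

theorem waveSum_add {n : ℕ} (κ : (Fin n → ℤ) → EuclideanSpace ℝ (Fin n))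
    {c d : (Fin n → ℤ) → ℂ} (hc : Summable fun k => ‖c k‖) (hd : Summable fun k => ‖d k‖)
    (x : EuclideanSpace ℝ (Fin n)) :
    waveSum κ (fun k => c k + d k) x = waveSum κ c x + waveSum κ d x := by
  simp only [waveSum, add_mul]
  exact (summable_mul_wave κ hc x).tsum_add (summable_mul_wave κ hd x)

theorem waveSum_const_mul {n : ℕ} (κ : (Fin n → ℤ) → EuclideanSpace ℝ (Fin n)) (z : ℂ)
    (c : (Fin n → ℤ) → ℂ) (x : EuclideanSpace ℝ (Fin n)) :
    waveSum κ (fun k => z * c k) x = z * waveSum κ c x := by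
  simp only [waveSum, mul_assoc, tsum_mul_left]

theorem eLap_cexp_cform_mul_one_add_waveSum {n : ℕ} {p w : EuclideanSpace ℝ (Fin n)}
    (hpw : inner ℝ p w = 0) (hn : ‖p‖ = ‖w‖) {κ : (Fin n → ℤ) → EuclideanSpace ℝ (Fin n)} {M : ℝ}
    (hκ : ∀ k, ‖κ k‖ ≤ M * (1 + ‖k‖)) {b : (Fin n → ℤ) → ℂ} (hb : RapidDecay b)
    (x : EuclideanSpace ℝ (Fin n)) :
    eLap (fun y => Complex.exp (cform p w y) * (1 + waveSum κ b y)) x =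
      Complex.exp (cform p w x) * waveSum κ (fun k => b k * conjSymbol p w (κ k)) x := by
  have hgrow (j : Fin n) (k : Fin n → ℤ) :
      ‖Complex.I * (inner ℝ (κ k) (EuclideanSpace.single j (1 : ℝ)) : ℝ)‖ ≤
        M * (1 + ‖k‖) ^ 1 := by
    rw [norm_mul, Complex.norm_I, one_mul, Complex.norm_real, pow_one]
    refine ((norm_inner_le_norm _ _).trans ?_).trans (hκ k)
    simp
  have hb1 (j : Fin n) := hb.mul_of_growth (hgrow j)
  have hb2 (j : Fin n) := (hb1 j).mul_of_growth (hgrow j)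
  have hd (e y : EuclideanSpace ℝ (Fin n)) :
      fderiv ℝ (fun y => 1 + waveSum κ b y) y e =
        waveSum κ (fun k => b k * (Complex.I * (inner ℝ (κ k) e : ℝ))) y := by
    rw [fderiv_const_add, fderiv_waveSum hκ hb]
  rw [eLap_cexp_cform_mul p w x (contDiff_const.add (contDiff_waveSum hκ hb)),
    sum_cform_single_sq hpw hn, zero_mul, zero_add]
  congr 1
  simp only [hd]
  simp only [fderiv_waveSum hκ (hb1 _), conjSymbol_eq_sum, Finset.mul_sum]
  rw [waveSum_sum]
  · refine Finset.sum_congr rfl fun j _ => ?_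
    rw [← waveSum_const_mul, ← waveSum_add]
    · congr 1
      funext k
      ring
    · simpa using (hb1 j).summable_norm.mul_left ‖2 * cform p w (EuclideanSpace.single j 1)‖
    · exact (hb2 j).summable_norm
  · intro j _
    have h1 := ((hb1 j).summable_norm.mul_left
      ‖2 * cform p w (EuclideanSpace.single j 1)‖).add (hb2 j).summable_norm
    refine Summable.of_nonneg_of_le (fun k => norm_nonneg _) (fun k => ?_) h1
    rw [← norm_mul]
    refine le_trans (le_of_eq ?_) (norm_add_le _ _)
    congr 1
    ring

theorem conjSymbol_re {n : ℕ} (p w ξ : EuclideanSpace ℝ (Fin n)) :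
    (conjSymbol p w ξ).re = -(2 * inner ℝ w ξ) - ‖ξ‖ ^ 2 := by
  simp [conjSymbol, cform, -Complex.ofReal_pow]

theorem conjSymbol_im {n : ℕ} (p w ξ : EuclideanSpace ℝ (Fin n)) :
    (conjSymbol p w ξ).im = 2 * inner ℝ p ξ := by
  simp [conjSymbol, cform, -Complex.ofReal_pow]

theorem exists_mul_one_add_norm_le_norm_conjSymbol {n : ℕ} (p w : EuclideanSpace ℝ (Fin n)) {δ : ℝ}
    (hδ : 0 < δ) : ∃ c, 0 < c ∧ ∀ ξ, δ ≤ ‖conjSymbol p w ξ‖ →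
      c * (1 + ‖ξ‖) ≤ ‖conjSymbol p w ξ‖ := by
  have hW := norm_nonneg w
  refine ⟨min 1 (δ / (2 * ‖w‖ + 3)), by positivity, fun ξ hξ => ?_⟩
  by_cases h : 2 * ‖w‖ + 2 ≤ ‖ξ‖
  · refine (mul_le_of_le_one_left (by positivity) (min_le_left _ _)).trans ?_
    refine le_trans ?_ (Complex.abs_re_le_norm _)
    refine le_trans ?_ (neg_le_abs _)
    rw [conjSymbol_re]
    have := neg_le_of_abs_le (abs_real_inner_le_norm w ξ)
    nlinarith [norm_nonneg ξ]
  · refine le_trans ?_ hξ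
    calc min 1 (δ / (2 * ‖w‖ + 3)) * (1 + ‖ξ‖) ≤ δ / (2 * ‖w‖ + 3) * (2 * ‖w‖ + 3) := by
          refine mul_le_mul (min_le_right _ _) ?_ (by positivity) (by positivity)
          linarith
      _ = δ := by field_simp

theorem inner_latVec {n : ℕ} (k l : Fin n → ℤ) :
    inner ℝ (latVec k) (latVec l) = ((∑ i, k i * l i : ℤ) : ℝ) := by
  simp [latVec, PiLp.inner_apply, mul_comm]

theorem norm_latVec_pos {n : ℕ} {k : Fin n → ℤ} (hk : k ≠ 0) : 0 < ‖latVec k‖ :=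
  (norm_pos_iff.mpr hk).trans_le (norm_le_norm_latVec k)

theorem norm_latVec_le {n : ℕ} (k : Fin n → ℤ) : ‖latVec k‖ ≤ √n * ‖k‖ := by
  rw [EuclideanSpace.norm_eq, Real.sqrt_le_iff]
  refine ⟨by positivity, ?_⟩
  rw [mul_pow, Real.sq_sqrt (by positivity)]
  calc ∑ i, ‖latVec k i‖ ^ 2 ≤ ∑ _i : Fin n, ‖k‖ ^ 2 := by
        gcongr with i
        simpa [latVec, Int.norm_eq_abs] using norm_le_pi_norm k i
    _ = n * ‖k‖ ^ 2 := by simp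

theorem half_le_abs_inner_latVec {n : ℕ} {m : Fin n → ℤ} (hm : m ≠ 0) {s : ℝ} (hs : 0 < s)
    (k : Fin n → ℤ) :
    s / 2 ≤ |inner ℝ (latVec m) (s • latVec k + (s / (2 * ‖latVec m‖ ^ 2)) • latVec m)| := by
  have hm' := norm_latVec_pos hm
  rw [inner_add_right, inner_smul_right, inner_smul_right, real_inner_self_eq_norm_sq,
    inner_latVec]
  set z := ∑ i, m i * k i
  have h1 : s * (z : ℝ) + s / (2 * ‖latVec m‖ ^ 2) * ‖latVec m‖ ^ 2 =
      s / 2 * ((2 * z + 1 : ℤ) : ℝ) := by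
    push_cast
    field_simp
  rw [h1, abs_mul, abs_of_pos (by positivity)]
  have h2 : (1 : ℝ) ≤ |((2 * z + 1 : ℤ) : ℝ)| := by
    rw [← Int.cast_abs]
    exact_mod_cast Int.one_le_abs (by omega)
  nlinarith

/-- Complex geometrical optics solutions of `Δ u = q u` whose complex frequency has real part
along a fixed lattice direction. -/
theorem exists_cgo {n : ℕ} {R : ℝ} (hR : 0 < R) {q : EuclideanSpace ℝ (Fin n) → ℂ}
    (hq : ContDiff ℝ (⊤ : ℕ∞) q) {m : Fin n → ℤ} (hm : m ≠ 0) :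
    ∃ C, 0 < C ∧ ∀ (σ : ℝ) (w : EuclideanSpace ℝ (Fin n)), C ≤ |σ| →
      inner ℝ (latVec m) w = 0 → ‖w‖ = |σ| * ‖latVec m‖ →
      ∃ r : EuclideanSpace ℝ (Fin n) → ℂ, ContDiff ℝ (⊤ : ℕ∞) r ∧ (∀ x, ‖r x‖ ≤ C / |σ|) ∧
        ∀ x, ‖x‖ < R →
          eLap (fun y => Complex.exp (cform (σ • latVec m) w y) * (1 + r y)) x =
            q x * (Complex.exp (cform (σ • latVec m) w x) * (1 + r x)) := by
  obtain ⟨s, hs⟩ : ∃ s, s = 2 * Real.pi / (8 * R) := ⟨_, rfl⟩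
  have hs0 : 0 < s := hs ▸ by positivity
  obtain ⟨θ, hθ⟩ : ∃ θ, θ = (s / (2 * ‖latVec m‖ ^ 2)) • latVec m := ⟨_, rfl⟩
  obtain ⟨a, ha, haq⟩ := exists_rapidDecay_hasSum hR q hq
  obtain ⟨g, hg, hgq⟩ := exists_rapidDecay_hasSum hR (fun x => q x * wave (-θ) x)
    (hq.mul (contDiff_wave _))
  rw [← hs] at haq hgq
  have has := ha.summable_norm
  have hgs := hg.summable_norm
  have hA : 0 ≤ ∑' k, ‖a k‖ := tsum_nonneg fun k => norm_nonneg _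
  have hG : 0 ≤ ∑' k, ‖g k‖ := tsum_nonneg fun k => norm_nonneg _
  refine ⟨1 + 2 * (∑' k, ‖a k‖) / s + 2 * (∑' k, ‖g k‖) / s, by positivity,
    fun σ w hσ hmw hw => ?_⟩
  have hσ0 : 0 < |σ| := lt_of_lt_of_le (by positivity) hσ
  have hsmall : 2 * ∑' k, ‖a k‖ ≤ |σ| * s := by
    rw [← div_le_iff₀ hs0]
    refine le_trans ?_ hσ
    have : 0 ≤ 2 * (∑' k, ‖g k‖) / s := by positivity
    linarith
  let κ : (Fin n → ℤ) → EuclideanSpace ℝ (Fin n) := fun k => s • latVec k + θ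
  let p := σ • latVec m
  have hpw : inner ℝ p w = 0 := by rw [inner_smul_left, hmw, mul_zero]
  have hpn : ‖p‖ = ‖w‖ := by rw [norm_smul, hw, Real.norm_eq_abs]
  have hδ : 0 < |σ| * s := by positivity
  have hd (k : Fin n → ℤ) : |σ| * s ≤ ‖conjSymbol p w (κ k)‖ := by
    refine le_trans ?_ (Complex.abs_im_le_norm _)
    rw [conjSymbol_im, inner_smul_left, abs_mul, abs_mul]
    have := half_le_abs_inner_latVec hm hs0 k
    rw [← hθ] at this
    simp only [conj_trivial, abs_two]
    nlinarith
  obtain ⟨b, hb, hbeq, hbn⟩ := exists_mul_eq_add_conv hδ has hgs hd hsmall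
  have hgrow : ∃ c, 0 < c ∧ ∀ k, c * (1 + ‖k‖) ≤ ‖conjSymbol p w (κ k)‖ := by
    obtain ⟨c, hc, hcb⟩ := exists_mul_one_add_norm_le_norm_conjSymbol p w hδ
    refine ⟨c * (s / (s + 1 + ‖θ‖)), by positivity, fun k => ?_⟩
    refine le_trans ?_ (hcb _ (hd k))
    rw [mul_assoc]
    refine mul_le_mul_of_nonneg_left ?_ hc.le
    rw [div_mul_eq_mul_div, div_le_iff₀ (by positivity)]
    have h1 : s * ‖k‖ ≤ ‖κ k‖ + ‖θ‖ := by
      calc s * ‖k‖ ≤ ‖s • latVec k‖ := by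
            rw [norm_smul, Real.norm_of_nonneg hs0.le]
            gcongr
            exact norm_le_norm_latVec k
        _ = ‖κ k - θ‖ := by simp [κ]
        _ ≤ _ := norm_sub_le _ _
    have := norm_nonneg (κ k)
    have := norm_nonneg θ
    nlinarith [mul_nonneg (norm_nonneg (κ k)) (norm_nonneg θ),
      mul_nonneg hs0.le (norm_nonneg (κ k))]
  obtain ⟨c, hc, hcb⟩ := hgrow
  have hbr : RapidDecay b := rapidDecay_of_mul_eq_add_conv hc ha hg hb hcb hbeq
  have hκ (k : Fin n → ℤ) : ‖κ k‖ ≤ (s * √n + ‖θ‖) * (1 + ‖k‖) := by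
    have h1 : ‖κ k‖ ≤ s * ‖latVec k‖ + ‖θ‖ := by
      refine (norm_add_le _ _).trans (le_of_eq ?_)
      rw [norm_smul, Real.norm_of_nonneg hs0.le]
    have h2 := mul_le_mul_of_nonneg_left (norm_latVec_le k) hs0.le
    have h3 : 0 ≤ ‖θ‖ * ‖k‖ := by positivity
    have h4 : 0 ≤ s * √n := by positivity
    linarith
  refine ⟨waveSum κ b, contDiff_waveSum hκ hbr, fun x => ?_, fun x hx => ?_⟩
  · refine (norm_waveSum_le κ hb x).trans (hbn.trans ?_)
    rw [div_mul_eq_mul_div, div_le_div_iff₀ hδ hσ0]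
    have : 0 ≤ (1 + 2 * (∑' k, ‖a k‖) / s) * s := by positivity
    have h3 : 2 * (∑' k, ‖g k‖) / s * s = 2 * ∑' k, ‖g k‖ := by field_simp
    nlinarith
  · have hgx : waveSum κ g x = q x := by
      have h1 := ((hgq x hx).mul_right (wave θ x)).tsum_eq
      rw [mul_assoc, ← wave_add, neg_add_cancel] at h1
      simp only [mul_assoc, ← wave_add] at h1
      simpa [wave, waveSum, κ] using h1
    have hax : waveSum (fun k => s • latVec k) a x = q x := (haq x hx).tsum_eq
    rw [eLap_cexp_cform_mul_one_add_waveSum hpw hpn hκ hbr]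
    have h2 : waveSum κ (fun k => b k * conjSymbol p w (κ k)) x = q x + q x * waveSum κ b x := by
      simp only [mul_comm (b _), hbeq]
      rw [waveSum_add κ hgs (summable_norm_conv has hb), hgx, waveSum_conv s θ has hb, hax]
    rw [h2]
    ring

theorem integrableOn_of_continuous_of_isBounded {n : ℕ} {E : Type*} [NormedAddCommGroup E]
    {Ω : Set (EuclideanSpace ℝ (Fin n))} (hΩ : Bornology.IsBounded Ω)
    {f : EuclideanSpace ℝ (Fin n) → E} (hf : Continuous f) : IntegrableOn f Ω :=
  (hf.continuousOn.integrableOn_compact hΩ.isCompact_closure).mono_set subset_closure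

theorem exists_ne_zero_sum_mul_eq_zero {n : ℕ} (hn : 2 ≤ n) (k : Fin n → ℤ) :
    ∃ m : Fin n → ℤ, m ≠ 0 ∧ ∑ i, m i * k i = 0 := by
  let i₀ : Fin n := ⟨0, by omega⟩
  let i₁ : Fin n := ⟨1, by omega⟩
  have hne : i₀ ≠ i₁ := by simp [i₀, i₁]
  by_cases h : k i₀ = 0
  · exact ⟨Pi.single i₀ 1, by simp, by simp [Pi.single_apply, h]⟩
  · refine ⟨Pi.single i₀ (k i₁) - Pi.single i₁ (k i₀), fun h0 => h ?_, ?_⟩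
    · have := congrFun h0 i₁
      simpa [Pi.single_apply, hne.symm] using this
    · simp only [Pi.sub_apply, sub_mul, Finset.sum_sub_distrib, Pi.single_apply, ite_mul,
        zero_mul, Finset.sum_ite_eq', Finset.mem_univ, if_true]
      ring

theorem exists_norm_eq_one_inner_eq_zero {n : ℕ} (hn : 3 ≤ n) (a b : EuclideanSpace ℝ (Fin n)) :
    ∃ ν : EuclideanSpace ℝ (Fin n), ‖ν‖ = 1 ∧ inner ℝ a ν = 0 ∧ inner ℝ b ν = 0 := by
  let S := Submodule.span ℝ (Set.range ![a, b])
  have hS : Sᗮ ≠ ⊥ := by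
    intro h
    have h1 := S.finrank_add_finrank_orthogonal
    rw [h, finrank_bot, finrank_euclideanSpace_fin] at h1
    have h2 := finrank_range_le_card (R := ℝ) ![a, b]
    simp only [Set.finrank, Fintype.card_fin] at h2
    change Module.finrank ℝ S ≤ 2 at h2
    omega
  obtain ⟨v, hv, hv0⟩ := Submodule.exists_mem_ne_zero_of_ne_bot hS
  have ha : inner ℝ a v = 0 := hv a (Submodule.subset_span ⟨0, rfl⟩)
  have hb : inner ℝ b v = 0 := hv b (Submodule.subset_span ⟨1, rfl⟩)
  exact ⟨‖v‖⁻¹ • v, norm_smul_inv_norm hv0, by simp [inner_smul_right, ha],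
    by simp [inner_smul_right, hb]⟩

/-- A vector orthogonal to `p` can be split into two vectors orthogonal to `p` of any
prescribed equal length that is large enough. -/
theorem exists_add_eq_norm_eq {n : ℕ} (hn : 3 ≤ n) {p ξ : EuclideanSpace ℝ (Fin n)}
    (hpξ : inner ℝ p ξ = 0) {ρ : ℝ} (hρ : ‖ξ‖ / 2 ≤ ρ) :
    ∃ w₁ w₂ : EuclideanSpace ℝ (Fin n), w₁ + w₂ = ξ ∧ inner ℝ p w₁ = 0 ∧ inner ℝ p w₂ = 0 ∧
      ‖w₁‖ = ρ ∧ ‖w₂‖ = ρ := by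
  obtain ⟨ν, hν, hpν, hξν⟩ := exists_norm_eq_one_inner_eq_zero hn p ξ
  have h0 : 0 ≤ ‖ξ‖ / 2 := by positivity
  have hρ0 : 0 ≤ ρ := h0.trans hρ
  have hsq : 0 ≤ ρ ^ 2 - (‖ξ‖ / 2) ^ 2 := by nlinarith
  let t := √(ρ ^ 2 - (‖ξ‖ / 2) ^ 2)
  have ht : t ^ 2 = ρ ^ 2 - (‖ξ‖ / 2) ^ 2 := Real.sq_sqrt hsq
  have hnorm (τ : ℝ) (hτ : τ ^ 2 = t ^ 2) : ‖(1 / 2 : ℝ) • ξ + τ • ν‖ = ρ := by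
    rw [← sq_eq_sq₀ (norm_nonneg _) hρ0, norm_add_sq_real, inner_smul_left, inner_smul_right, hξν,
      norm_smul, norm_smul, hν, mul_pow, mul_pow, Real.norm_eq_abs τ, sq_abs, hτ, ht]
    norm_num
    ring
  refine ⟨(1 / 2 : ℝ) • ξ + t • ν, (1 / 2 : ℝ) • ξ + (-t) • ν, by module, ?_, ?_, hnorm t rfl,
    hnorm (-t) (neg_sq t)⟩
  · simp [inner_add_right, inner_smul_right, hpξ, hpν]
  · simp [inner_add_right, inner_smul_right, hpξ, hpν]

theorem cexp_cform_mul_cexp_cform_neg {n : ℕ} (p w₁ w₂ x : EuclideanSpace ℝ (Fin n)) :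
    Complex.exp (cform p w₁ x) * Complex.exp (cform (-p) w₂ x) = wave (w₁ + w₂) x := by
  rw [← Complex.exp_add, wave, cform, cform, inner_add_left, inner_neg_left]
  push_cast
  ring_nf

theorem integral_mul_wave_eq_zero {n : ℕ} (hn : 3 ≤ n) {Ω : Set (EuclideanSpace ℝ (Fin n))}
    (hΩbd : Bornology.IsBounded Ω) {R : ℝ} (hR : 0 < R)
    (hΩR : ∀ x ∈ Ω, ‖x‖ < R) {q₁ q₂ : EuclideanSpace ℝ (Fin n) → ℂ}
    (hq₁ : ContDiff ℝ (⊤ : ℕ∞) q₁) (hq₂ : ContDiff ℝ (⊤ : ℕ∞) q₂)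
    (horth : ∀ u₁ u₂ : EuclideanSpace ℝ (Fin n) → ℂ,
      ContDiff ℝ (⊤ : ℕ∞) u₁ → ContDiff ℝ (⊤ : ℕ∞) u₂ →
      (∀ x ∈ Ω, eLap u₁ x = q₁ x * u₁ x) → (∀ x ∈ Ω, eLap u₂ x = q₂ x * u₂ x) →
      (∫ x in Ω, (q₁ x - q₂ x) * u₁ x * u₂ x) = 0) (s : ℝ) (k : Fin n → ℤ) :
    ∫ x in Ω, (q₁ x - q₂ x) * wave (s • latVec k) x = 0 := by
  obtain ⟨m, hm, hmk⟩ := exists_ne_zero_sum_mul_eq_zero (by omega) k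
  obtain ⟨C₁, hC₁, H₁⟩ := exists_cgo hR hq₁ hm
  obtain ⟨C₂, hC₂, H₂⟩ := exists_cgo hR hq₂ hm
  have hM := norm_latVec_pos hm
  have hmξ : inner ℝ (latVec m) (s • latVec k) = 0 := by
    rw [inner_smul_right, inner_latVec, hmk]
    simp
  have hQ : Continuous fun x => q₁ x - q₂ x := hq₁.continuous.sub hq₂.continuous
  have hlim : Filter.Tendsto (fun σ : ℝ => (∫ x in Ω, ‖q₁ x - q₂ x‖) *
      (C₁ / σ + C₂ / σ + C₁ / σ * (C₂ / σ))) Filter.atTop (nhds 0) := by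
    have h (C : ℝ) : Filter.Tendsto (fun σ : ℝ => C / σ) Filter.atTop (nhds 0) :=
      Filter.tendsto_id.const_div_atTop C
    simpa using (((h C₁).add (h C₂)).add ((h C₁).mul (h C₂))).const_mul
      (∫ x in Ω, ‖q₁ x - q₂ x‖)
  refine norm_le_zero_iff.mp (ge_of_tendsto hlim ?_)
  filter_upwards [Filter.eventually_ge_atTop C₁, Filter.eventually_ge_atTop C₂,
    Filter.eventually_ge_atTop (‖s • latVec k‖ / 2 / ‖latVec m‖)] with σ h₁ h₂ h₃
  have hσ : 0 < σ := hC₁.trans_le h₁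
  rw [div_le_iff₀ hM] at h₃
  obtain ⟨w₁, w₂, hw, hmw₁, hmw₂, hw₁, hw₂⟩ := exists_add_eq_norm_eq hn hmξ h₃
  obtain ⟨r₁, hr₁, hrb₁, hu₁⟩ := H₁ σ w₁ (by rwa [abs_of_pos hσ]) hmw₁ (by rwa [abs_of_pos hσ])
  obtain ⟨r₂, hr₂, hrb₂, hu₂⟩ := H₂ (-σ) w₂ (by rwa [abs_neg, abs_of_pos hσ]) hmw₂
    (by rwa [abs_neg, abs_of_pos hσ])
  rw [abs_of_pos hσ] at hrb₁
  rw [abs_neg, abs_of_pos hσ] at hrb₂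
  have h0 := horth _ _ ((contDiff_cform _ w₁).cexp.mul (contDiff_const.add hr₁))
    ((contDiff_cform _ w₂).cexp.mul (contDiff_const.add hr₂))
    (fun x hx => hu₁ x (hΩR x hx)) (fun x hx => hu₂ x (hΩR x hx))
  have hprod (x : EuclideanSpace ℝ (Fin n)) :
      (q₁ x - q₂ x) * (Complex.exp (cform (σ • latVec m) w₁ x) * (1 + r₁ x)) *
        (Complex.exp (cform (-σ • latVec m) w₂ x) * (1 + r₂ x)) =
      (q₁ x - q₂ x) * wave (s • latVec k) x * ((1 + r₁ x) * (1 + r₂ x)) := by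
    rw [← hw, ← cexp_cform_mul_cexp_cform_neg (σ • latVec m), neg_smul]
    ring
  simp only [hprod] at h0
  have hwave : Continuous (wave (s • latVec k)) := (contDiff_wave _).continuous
  have hi₁ : IntegrableOn (fun x => (q₁ x - q₂ x) * wave (s • latVec k) x) Ω :=
    integrableOn_of_continuous_of_isBounded hΩbd (hQ.mul hwave)
  have hi₂ : IntegrableOn
      (fun x => (q₁ x - q₂ x) * wave (s • latVec k) x * ((1 + r₁ x) * (1 + r₂ x))) Ω :=
    integrableOn_of_continuous_of_isBounded hΩbd ((hQ.mul hwave).mul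
      ((continuous_const.add hr₁.continuous).mul (continuous_const.add hr₂.continuous)))
  rw [← sub_zero (∫ x in Ω, _), ← h0, ← integral_sub hi₁ hi₂, ← integral_mul_const]
  refine norm_integral_le_of_norm_le
    ((integrableOn_of_continuous_of_isBounded hΩbd hQ.norm).mul_const _)
    (Filter.Eventually.of_forall fun x => ?_)
  have h : (q₁ x - q₂ x) * wave (s • latVec k) x -
      (q₁ x - q₂ x) * wave (s • latVec k) x * ((1 + r₁ x) * (1 + r₂ x)) =
      -((q₁ x - q₂ x) * wave (s • latVec k) x * (r₁ x + r₂ x + r₁ x * r₂ x)) := by ring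
  rw [h, norm_neg, norm_mul, norm_mul, norm_wave, mul_one]
  refine mul_le_mul_of_nonneg_left ?_ (norm_nonneg _)
  refine (norm_add₃_le).trans ?_
  rw [norm_mul]
  have := hrb₁ x
  have := hrb₂ x
  gcongr

theorem eqOn_zero_of_integral_mul_wave_eq_zero {n : ℕ} {Ω : Set (EuclideanSpace ℝ (Fin n))}
    (hΩ : IsOpen Ω) (hΩbd : Bornology.IsBounded Ω) {R : ℝ} (hR : 0 < R)
    (hΩR : ∀ x ∈ Ω, ‖x‖ < R) {f : EuclideanSpace ℝ (Fin n) → ℂ} (hf : ContDiff ℝ (⊤ : ℕ∞) f)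
    (h : ∀ k : Fin n → ℤ, ∫ x in Ω, f x * wave ((2 * Real.pi / (8 * R)) • latVec k) x = 0) :
    Set.EqOn f 0 Ω := by
  obtain ⟨a, ha, haf⟩ := exists_rapidDecay_hasSum hR (fun x => (starRingEnd ℂ) (f x))
    (Complex.conjCLE.contDiff.comp hf)
  have hf_int (k : Fin n → ℤ) : IntegrableOn
      (fun x => f x * (a k * wave ((2 * Real.pi / (8 * R)) • latVec k) x)) Ω :=
    integrableOn_of_continuous_of_isBounded hΩbd
      (hf.continuous.mul (continuous_const.mul (contDiff_wave _).continuous))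
  have hsum := hasSum_integral_of_summable_integral_norm hf_int (by
    simp only [norm_mul, norm_wave, mul_one, integral_mul_const]
    exact ha.summable_norm.mul_left _)
  have hzero : ∫ x in Ω, ‖f x‖ ^ 2 = 0 := by
    have h1 (k : Fin n → ℤ) :
        ∫ x in Ω, f x * (a k * wave ((2 * Real.pi / (8 * R)) • latVec k) x) = 0 := by
      simp only [mul_left_comm _ (a k), integral_const_mul, h, mul_zero]
    simp only [h1] at hsum
    have h2 := hsum.unique hasSum_zero
    have h3 : ∫ x in Ω, ((‖f x‖ ^ 2 : ℝ) : ℂ) = 0 := by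
      rw [← h2]
      refine setIntegral_congr_fun hΩ.measurableSet fun x hx => ?_
      simp only [tsum_mul_left]
      rw [(haf x (hΩR x hx)).tsum_eq, Complex.mul_conj, Complex.normSq_eq_norm_sq]
    rw [integral_complex_ofReal] at h3
    exact_mod_cast h3
  have hae := (integral_eq_zero_iff_of_nonneg (f := fun x => ‖f x‖ ^ 2) (fun x => by positivity)
    (integrableOn_of_continuous_of_isBounded hΩbd (hf.continuous.norm.pow 2))).mp hzero
  refine Measure.eqOn_open_of_ae_eq (μ := volume) (g := 0) ?_ hΩ hf.continuous.continuousOn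
    continuousOn_const
  filter_upwards [hae] with x hx
  simpa using hx

theorem statement19 {n : ℕ} (hn : 3 ≤ n) (Ω : Set (EuclideanSpace ℝ (Fin n)))
    (hΩ : IsOpen Ω) (hΩbd : Bornology.IsBounded Ω)
    (q₁ q₂ : EuclideanSpace ℝ (Fin n) → ℂ)
    (hq₁ : ContDiff ℝ (⊤ : ℕ∞) q₁) (hq₂ : ContDiff ℝ (⊤ : ℕ∞) q₂)
    (horth : ∀ u₁ u₂ : EuclideanSpace ℝ (Fin n) → ℂ,
      ContDiffOn ℝ (⊤ : ℕ∞) u₁ Ω → ContDiffOn ℝ (⊤ : ℕ∞) u₂ Ω →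
      (∀ x ∈ Ω, eLap u₁ x = q₁ x * u₁ x) →
      (∀ x ∈ Ω, eLap u₂ x = q₂ x * u₂ x) →
      IntegrableOn (fun x => ‖u₁ x‖ ^ 2 + ‖fderiv ℝ u₁ x‖ ^ 2) Ω →
      IntegrableOn (fun x => ‖u₂ x‖ ^ 2 + ‖fderiv ℝ u₂ x‖ ^ 2) Ω →
      (∫ x in Ω, (q₁ x - q₂ x) * u₁ x * u₂ x) = 0) :
    ∀ x ∈ Ω, q₁ x = q₂ x := by
  obtain ⟨R, hR, hΩR⟩ := hΩbd.exists_pos_norm_lt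
  have hfin {u : EuclideanSpace ℝ (Fin n) → ℂ} (hu : ContDiff ℝ (⊤ : ℕ∞) u) :
      IntegrableOn (fun x => ‖u x‖ ^ 2 + ‖fderiv ℝ u x‖ ^ 2) Ω :=
    integrableOn_of_continuous_of_isBounded hΩbd
      ((hu.continuous.norm.pow 2).add ((hu.continuous_fderiv (by simp)).norm.pow 2))
  have h := eqOn_zero_of_integral_mul_wave_eq_zero hΩ hΩbd hR hΩR (hq₁.sub hq₂)
    (integral_mul_wave_eq_zero hn hΩbd hR hΩR hq₁ hq₂ (fun u₁ u₂ hu₁ hu₂ h₁ h₂ =>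
      horth u₁ u₂ hu₁.contDiffOn hu₂.contDiffOn h₁ h₂ (hfin hu₁) (hfin hu₂)) _)
  exact fun x hx => sub_eq_zero.mp (h hx)
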